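/- arXiv:1912.03438 — 4 statements merged into one kernel-verified Lean document; each statement's English description precedes it below -/
import Mathlib

section
/- Fix α > 0 and p > 0. For all sufficiently large N there exists a unique a_N in the interval (0, e^{−1/p}) satisfying α (a_N)^p ln(1/a_N) = 1/N, and this solution satisfies lim_{N→∞} a_N · (α N ln(N)/p)^{1/p} = 1. In other words, the solution a_N of α a^p ln(1/a) = 1/N is asymptotically equivalent to (α N ln(N)/p)^{−1/p} as N → ∞. -/
open Filter Set

lemma lt_aux {x y : ℝ} (hx : 1 < x) (hxy : x < y) : x - Real.log x < y - Real.log y := by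
  have hx0 : 0 < x := by linarith
  have hy0 : 0 < y := by linarith
  have h1 : Real.log (y / x) < y / x - 1 := by
    apply Real.log_lt_sub_one_of_pos (by positivity)
    intro h
    rw [div_eq_one_iff_eq hx0.ne'] at h
    linarith
  rw [Real.log_div hy0.ne' hx0.ne'] at h1
  have h2 : y / x - 1 ≤ y - x := by
    rw [div_sub_one hx0.ne', div_le_iff₀ hx0]
    nlinarith
  linarith

lemma ex_aux {L : ℝ} (hL : 1 < L) : ∃ x : ℝ, 1 < x ∧ x - Real.log x = L := by
  have hc : ContinuousOn (fun x : ℝ => x - Real.log x) (Icc 1 (2 * L)) := by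
    apply ContinuousOn.sub continuousOn_id
    apply Real.continuousOn_log.mono
    intro x hx
    have := hx.1
    simp only [mem_compl_iff, mem_singleton_iff]
    linarith
  have h := intermediate_value_Icc (by linarith : (1 : ℝ) ≤ 2 * L) hc
  have hl : Real.log (2 * L) ≤ L := by
    rw [Real.log_mul (by norm_num) (by linarith)]
    have := Real.log_le_sub_one_of_pos (by linarith : 0 < L)
    have := Real.log_two_lt_d9
    linarith
  have hm : L ∈ Icc ((fun x : ℝ => x - Real.log x) 1) ((fun x : ℝ => x - Real.log x) (2 * L)) := by
    constructor
    · simp; linarith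
    · simp only; linarith
  obtain ⟨x, hx, hxL⟩ := h hm
  refine ⟨x, lt_of_le_of_ne hx.1 ?_, hxL⟩
  rintro rfl
  simp at hxL
  linarith

lemma eqn_aux {α p x n : ℝ} (hα : 0 < α) (hp : 0 < p) (hx : 1 < x) (hn : 0 < n) :
    α * Real.exp (-(x / p)) ^ p * Real.log (1 / Real.exp (-(x / p))) = 1 / n ↔
      x - Real.log x = Real.log (α * n / p) := by
  have hx0 : 0 < x := by linarith
  have e1 : Real.exp (-(x / p)) ^ p = (Real.exp x)⁻¹ := by
    rw [← Real.exp_mul, ← Real.exp_neg]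
    congr 1
    field_simp
  have e2 : Real.log (1 / Real.exp (-(x / p))) = x / p := by
    rw [one_div, ← Real.exp_neg, Real.log_exp, neg_neg]
  have e3 : x - Real.log x = Real.log (Real.exp x / x) := by
    rw [Real.log_div (Real.exp_pos x).ne' hx0.ne', Real.log_exp]
  have hE := Real.exp_pos x
  rw [e1, e2, e3, Real.log_injOn_pos.eq_iff (by simp; positivity) (by simp; positivity)]
  field_simp
  constructor <;> intro h <;> linarith

/-- **Inversion of the logarithmic tail (Remark after Theorem 1):**
For `α > 0`, `p > 0`, for all sufficiently large `N` the equation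
`α a^p ln(1/a) = 1/N` has a unique solution `a_N ∈ (0, e^{-1/p})`, and this solution
satisfies `a_N (α N ln N / p)^{1/p} → 1` as `N → ∞`; i.e. `a_N` is asymptotically
equivalent to `(α N ln N / p)^{-1/p}`. -/
theorem log_tail_scaling_inversion (α p : ℝ) (hα : 0 < α) (hp : 0 < p) :
    ∃ aN : ℕ → ℝ,
      (∀ᶠ N : ℕ in atTop,
        aN N ∈ Set.Ioo (0 : ℝ) (Real.exp (-(1 / p))) ∧
        α * aN N ^ p * Real.log (1 / aN N) = 1 / N ∧
        ∀ b ∈ Set.Ioo (0 : ℝ) (Real.exp (-(1 / p))),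
          α * b ^ p * Real.log (1 / b) = 1 / N → b = aN N) ∧
      Tendsto (fun N : ℕ => aN N * ((α * N * Real.log N / p) ^ (1 / p) : ℝ))
        atTop (nhds 1) := by
  have hlog : Tendsto (fun N : ℕ => Real.log (N : ℝ)) atTop atTop :=
    Real.tendsto_log_atTop.comp tendsto_natCast_atTop_atTop
  have hL : Tendsto (fun N : ℕ => Real.log (α * N / p)) atTop atTop := by
    apply Real.tendsto_log_atTop.comp
    exact (tendsto_natCast_atTop_atTop.const_mul_atTop hα).atTop_div_const hp
  have hex : ∀ N : ℕ, ∃ x : ℝ, 1 < Real.log (α * N / p) →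
      1 < x ∧ x - Real.log x = Real.log (α * N / p) := by
    intro N
    by_cases h : 1 < Real.log (α * N / p)
    · obtain ⟨x, hx⟩ := ex_aux h
      exact ⟨x, fun _ => hx⟩
    · exact ⟨0, fun h' => absurd h' h⟩
  choose x hx using hex
  have hev : ∀ᶠ N : ℕ in atTop, 1 < Real.log (α * N / p) := hL.eventually_gt_atTop 1
  have hxt : Tendsto x atTop atTop := by
    apply tendsto_atTop_mono' _ _ hL
    filter_upwards [hev] with N hN
    have := hx N hN
    have := Real.log_nonneg this.1.le
    linarith
  refine ⟨fun N => Real.exp (-(x N / p)), ?_, ?_⟩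
  · filter_upwards [hev, eventually_gt_atTop 0] with N hN hN0
    have hN0' : (0 : ℝ) < N := by exact_mod_cast hN0
    obtain ⟨h1, h2⟩ := hx N hN
    refine ⟨⟨Real.exp_pos _, ?_⟩, (eqn_aux hα hp h1 hN0').2 h2, ?_⟩
    · apply Real.exp_lt_exp.2
      have := (div_lt_div_iff_of_pos_right hp).2 h1
      linarith
    · intro b hb hbe
      have hbx : b = Real.exp (-((-(p * Real.log b)) / p)) := by
        rw [show -((-(p * Real.log b)) / p) = Real.log b by field_simp, Real.exp_log hb.1]
      have hy : 1 < -(p * Real.log b) := by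
        have := (Real.log_lt_iff_lt_exp hb.1).2 hb.2
        have := mul_lt_mul_of_pos_left this hp
        have h3 : p * (-(1 / p)) = -1 := by field_simp
        linarith
      generalize -(p * Real.log b) = y at hbx hy
      subst hbx
      have h3 := (eqn_aux hα hp hy hN0').1 hbe
      have : y = x N := by
        rcases lt_trichotomy y (x N) with h | h | h
        · have := lt_aux hy h
          linarith
        · exact h
        · have := lt_aux h1 h
          linarith
      rw [this]
  · have hr : Tendsto (fun N : ℕ => 1 - Real.log (x N) / x N - Real.log (α / p) / x N)
        atTop (nhds 1) := by
      have h1 : Tendsto (fun N : ℕ => Real.log (x N) / x N) atTop (nhds 0) :=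
        (Real.isLittleO_log_id_atTop.tendsto_div_nhds_zero).comp hxt
      have h2 : Tendsto (fun N : ℕ => Real.log (α / p) / x N) atTop (nhds 0) :=
        hxt.const_div_atTop _
      simpa using (tendsto_const_nhds (x := (1 : ℝ))).sub h1 |>.sub h2
    have hr2 := hr.rpow_const (p := 1 / p) (Or.inl one_ne_zero)
    rw [Real.one_rpow] at hr2
    apply hr2.congr'
    filter_upwards [hev, eventually_gt_atTop 1] with N hN hN1
    have hN0' : (1 : ℝ) < N := by exact_mod_cast hN1
    have hN0 : (0 : ℝ) < N := by linarith
    obtain ⟨h1, h2⟩ := hx N hN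
    have hx0 : 0 < x N := by linarith
    have hl : 0 < Real.log N := Real.log_pos hN0'
    have e1 : Real.exp (-(x N / p)) = Real.exp (-(x N)) ^ (1 / p) := by
      rw [← Real.exp_mul]
      congr 1
      ring
    rw [e1, ← Real.mul_rpow (Real.exp_pos _).le (by positivity)]
    congr 1
    have e2 : Real.exp (x N) = α * N / p * x N := by
      have : x N = Real.log (α * N / p) + Real.log (x N) := by linarith
      rw [this, Real.exp_add, Real.exp_log (by positivity), Real.exp_log (by linarith), ← this]
    have e3 : Real.log (α * N / p) = Real.log (α / p) + Real.log N := by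
      rw [← Real.log_mul (by positivity) (by positivity)]
      congr 1
      ring
    rw [Real.exp_neg, e2]
    have e4 : Real.log N = x N - Real.log (x N) - Real.log (α / p) := by linarith
    rw [e4]
    field_simp
end

section
/- For ε > 0, define r(s,ε) := 1 + ε − s and x(s,ε) := (s^2 − r(s,ε)^2 + 1)/(2s). Then, as ε → 0+, ε/2 + (1/π) ∫_{ε/2}^{1} arccos((x(s,ε) − s)/r(s,ε)) ds = √2 · √ε + O(ε). -/
open Filter Set Asymptotics intervalIntegral

lemma rt_arcsin_bounds (z : ℝ) (h0 : 0 ≤ z) (h1 : z ≤ 1) :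
    2 * z ≤ Real.arccos (1 - 2 * z ^ 2) ∧ Real.arccos (1 - 2 * z ^ 2) ≤ 2 * (z + 8 * z ^ 3) := by
  obtain ⟨φ, hφ0, hφ1, rfl⟩ : ∃ φ, 0 ≤ φ ∧ φ ≤ Real.pi / 2 ∧ z = Real.sin φ :=
    ⟨Real.arcsin z, Real.arcsin_nonneg.2 h0, Real.arcsin_le_pi_div_two z,
      (Real.sin_arcsin (by linarith) h1).symm⟩
  have e : 1 - 2 * Real.sin φ ^ 2 = Real.cos (2 * φ) := by
    rw [Real.cos_two_mul]; nlinarith [Real.sin_sq_add_cos_sq φ]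
  rw [e, Real.arccos_cos (by linarith) (by linarith)]
  have hs := Real.sin_le hφ0
  have hj := Real.mul_le_sin hφ0 hφ1
  have hpi := Real.pi_lt_four
  have hpp := Real.pi_pos
  have hhalf : φ / 2 ≤ Real.sin φ := by
    refine le_trans ?_ hj
    have : 1 / 2 ≤ 2 / Real.pi := by
      rw [div_le_div_iff₀ (by norm_num) hpp]; linarith
    nlinarith
  refine ⟨by linarith, ?_⟩
  have h3 : (φ / 2) ^ 3 ≤ Real.sin φ ^ 3 := by gcongr
  by_cases h : φ ≤ 1
  · rcases hφ0.eq_or_lt with h' | h'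
    · subst h'; simp
    · have := Real.sin_gt_sub_cube h'
      have : 0 ≤ φ ^ 3 := by positivity
      nlinarith
  · push Not at h
    have : φ ≤ φ ^ 3 := by nlinarith [mul_pos (sub_pos.2 h) (sub_pos.2 h)]
    nlinarith

lemma rt_deriv (a s : ℝ) (hs : 0 < s) (hsa : s < a) :
    HasDerivAt (fun s => Real.arcsin ((2 * s - a) / a)) (1 / √(s * (a - s))) s ∧
    HasDerivAt (fun s => (2 / a ^ 2) * ((2 * s - a) / √(s * (a - s))))
      (1 / √(s * (a - s)) ^ 3) s := by
  have ha : 0 < a := hs.trans hsa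
  have hq : 0 < s * (a - s) := mul_pos hs (by linarith)
  have hp := Real.sqrt_pos.2 hq
  have hpp := Real.sq_sqrt hq.le
  have hl : HasDerivAt (fun s : ℝ => 2 * s - a) 2 s := by
    simpa using ((hasDerivAt_id s).const_mul 2).sub_const a
  constructor
  · have h1 : (2 * s - a) / a ≠ -1 := by
      intro h; rw [div_eq_iff ha.ne'] at h; linarith
    have h2 : (2 * s - a) / a ≠ 1 := by
      intro h; rw [div_eq_iff ha.ne'] at h; linarith
    have := (Real.hasDerivAt_arcsin h1 h2).comp s (hl.div_const a)
    refine this.congr_deriv ?_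
    have : √(1 - ((2 * s - a) / a) ^ 2) = 2 / a * √(s * (a - s)) := by
      rw [Real.sqrt_eq_iff_mul_self_eq_of_pos (by positivity)]
      have : 2 / a * √(s * (a - s)) * (2 / a * √(s * (a - s))) = 4 / a ^ 2 * √(s * (a - s)) ^ 2 := by
        field_simp; ring
      rw [this, hpp]; field_simp; ring
    rw [this]; field_simp
  · have hqd : HasDerivAt (fun s : ℝ => s * (a - s)) (a - 2 * s) s := by
      have := (hasDerivAt_id s).mul ((hasDerivAt_id s).const_sub a)
      refine this.congr_deriv ?_
      simp; ring
    have := ((hl.div (hqd.sqrt hq.ne') hp.ne').const_mul (2 / a ^ 2))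
    refine this.congr_deriv ?_
    set p := √(s * (a - s)) with hpdef
    field_simp
    have : p ^ 2 * 4 + (2 * s - a) ^ 2 = a ^ 2 := by rw [hpp]; ring
    linear_combination this

set_option maxHeartbeats 1000000 in
lemma rt_main (ε : ℝ) (h0 : 0 < ε) (h1 : ε < 1) :
    |ε / 2 + (1 / Real.pi)
            * (∫ s in (ε / 2)..1,
                Real.arccos
                  (((s ^ 2 - (1 + ε - s) ^ 2 + 1) / (2 * s) - s) / (1 + ε - s)))
          - Real.sqrt 2 * Real.sqrt ε| ≤ 100 * ε := by
  set a := 1 + ε with ha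
  set D := √((ε + ε ^ 2 / 2) / 2) with hD
  have hδ : 0 < (ε + ε ^ 2 / 2) / 2 := by positivity
  have hDp : 0 < D := Real.sqrt_pos.2 hδ
  have hD2 : D ^ 2 = (ε + ε ^ 2 / 2) / 2 := Real.sq_sqrt hδ.le
  set e := √ε with he
  have hep : 0 < e := Real.sqrt_pos.2 h0
  have he2 : e ^ 2 = ε := Real.sq_sqrt h0.le
  have hDe : D ≤ e := by
    apply Real.sqrt_le_sqrt; nlinarith
  have hab : ε / 2 ≤ 1 := by linarith
  have hmem : ∀ s ∈ Icc (ε / 2) 1, 0 < s ∧ s < a ∧ D ^ 2 ≤ s * (a - s) := by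
    rintro s ⟨hs1, hs2⟩
    refine ⟨by linarith, by linarith, ?_⟩
    rw [hD2]
    nlinarith [mul_nonneg (sub_nonneg.2 hs1) (by linarith : 0 ≤ a - s - ε / 2)]
  have hu : uIcc (ε / 2) 1 = Icc (ε / 2) 1 := uIcc_of_le hab
  have hq : ∀ s ∈ Icc (ε / 2) 1, √(s * (a - s)) ≠ 0 := fun s hs => by
    obtain ⟨h1, h2, -⟩ := hmem s hs
    exact (Real.sqrt_pos.2 (mul_pos h1 (by linarith))).ne'
  -- integrand
  have hb : ∀ s ∈ Icc (ε / 2) 1,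
      2 * D * (1 / √(s * (a - s))) ≤
        Real.arccos (((s ^ 2 - (a - s) ^ 2 + 1) / (2 * s) - s) / (a - s)) ∧
      Real.arccos (((s ^ 2 - (a - s) ^ 2 + 1) / (2 * s) - s) / (a - s)) ≤
        2 * D * (1 / √(s * (a - s))) + 16 * D ^ 3 * (1 / √(s * (a - s)) ^ 3) := by
    intro s hs
    obtain ⟨g1, g2, g3⟩ := hmem s hs
    have g4 : 0 < a - s := by linarith
    have hqq : 0 < s * (a - s) := mul_pos g1 g4
    have hp := Real.sqrt_pos.2 hqq
    have hz1 : D / √(s * (a - s)) ≤ 1 := by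
      rw [div_le_one hp]; exact Real.le_sqrt_of_sq_le g3
    have key : ((s ^ 2 - (a - s) ^ 2 + 1) / (2 * s) - s) / (a - s)
        = 1 - 2 * (D / √(s * (a - s))) ^ 2 := by
      rw [div_pow, hD2, Real.sq_sqrt hqq.le]
      field_simp
      rw [ha]; ring
    rw [key]
    obtain ⟨b1, b2⟩ := rt_arcsin_bounds _ (by positivity) hz1
    constructor
    · convert b1 using 1; ring
    · convert b2 using 1; ring
  have hc1 : ContinuousOn (fun s => 1 / √(s * (a - s))) (Icc (ε / 2) 1) := by
    apply ContinuousOn.div (by fun_prop) (by fun_prop) hq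
  have hc2 : ContinuousOn (fun s => 1 / √(s * (a - s)) ^ 3) (Icc (ε / 2) 1) := by
    apply ContinuousOn.div (by fun_prop) (by fun_prop) (fun s hs => pow_ne_zero _ (hq s hs))
  have hc3 : ContinuousOn (fun s =>
      Real.arccos (((s ^ 2 - (a - s) ^ 2 + 1) / (2 * s) - s) / (a - s))) (Icc (ε / 2) 1) := by
    apply Real.continuous_arccos.comp_continuousOn
    apply ContinuousOn.div _ (by fun_prop)
    · intro s hs; have := (hmem s hs).2.1; linarith
    apply ContinuousOn.sub _ (by fun_prop)
    apply ContinuousOn.div (by fun_prop) (by fun_prop)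
    intro s hs; have := (hmem s hs).1; positivity
  rw [← hu] at hc1 hc2 hc3
  have i1 := hc1.intervalIntegrable (μ := MeasureTheory.volume)
  have i2 := hc2.intervalIntegrable (μ := MeasureTheory.volume)
  have i3 := hc3.intervalIntegrable (μ := MeasureTheory.volume)
  have e1 := integral_eq_sub_of_hasDerivAt (fun s hs => by
    rw [hu] at hs; exact (rt_deriv a s (hmem s hs).1 (hmem s hs).2.1).1) i1
  have e2 := integral_eq_sub_of_hasDerivAt (fun s hs => by
    rw [hu] at hs; exact (rt_deriv a s (hmem s hs).1 (hmem s hs).2.1).2) i2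
  have lo := integral_mono_on hab (i1.const_mul (2 * D)) i3 (fun s hs => (hb s hs).1)
  have up := integral_mono_on hab i3 ((i1.const_mul (2 * D)).add (i2.const_mul (16 * D ^ 3)))
    (fun s hs => (hb s hs).2)
  rw [integral_add (i1.const_mul _) (i2.const_mul _), integral_const_mul, integral_const_mul,
    e1, e2] at up
  rw [integral_const_mul, e1] at lo
  set I := ∫ s in (ε / 2)..1,
    Real.arccos (((s ^ 2 - (a - s) ^ 2 + 1) / (2 * s) - s) / (a - s)) with hI
  have hap : 0 < a := by positivity
  -- arcsin at the ends
  have hend : ∀ t : ℝ, 1 - 2 * ε ≤ t → Real.pi / 2 - 18 * e ≤ Real.arcsin t := by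
    intro t ht
    have h := Real.arccos_le_arccos ht
    rw [← he2] at h
    have he1 : e ≤ 1 := by rw [he]; exact Real.sqrt_le_one.2 h1.le
    have := (rt_arcsin_bounds e hep.le he1).2
    have h3 : e ^ 3 ≤ e := by nlinarith [mul_nonneg hep.le hep.le, mul_nonneg (mul_nonneg hep.le hep.le) (sub_nonneg.2 he1)]
    rw [Real.arccos] at h
    linarith
  have l1 := hend ((2 * 1 - a) / a) (by rw [le_div_iff₀ hap, ha]; nlinarith)
  have l2 := hend (-((2 * (ε / 2) - a) / a)) (by
    rw [← neg_div, le_div_iff₀ hap, ha]; nlinarith)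
  have u1 := Real.arcsin_le_pi_div_two ((2 * 1 - a) / a)
  have u2 := Real.arcsin_le_pi_div_two (-((2 * (ε / 2) - a) / a))
  rw [Real.arcsin_neg] at l2 u2
  set A := Real.arcsin ((2 * 1 - a) / a)
  set B := Real.arcsin ((2 * (ε / 2) - a) / a)
  -- remainder
  have q1 : √(1 * (a - 1)) = e := by rw [he, ha]; congr 1; ring
  have q2 : √(ε / 2 * (a - ε / 2)) = D := by rw [hD, ha]; congr 1; ring
  rw [q1, q2] at up
  have hR : 16 * D ^ 3 * (2 / a ^ 2 * ((2 * 1 - a) / e) - 2 / a ^ 2 * ((2 * (ε / 2) - a) / D))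
      ≤ 64 * ε := by
    have ha2 : 2 / a ^ 2 ≤ 2 := by
      rw [div_le_iff₀ (by positivity)]; nlinarith
    have x1 : D ^ 3 * ((2 * 1 - a) / e) ≤ e ^ 2 := by
      rw [← mul_div_assoc, div_le_iff₀ hep]
      have : D ^ 3 ≤ e ^ 3 := by gcongr
      have : 0 < D ^ 3 := by positivity
      nlinarith
    have x2 : D ^ 3 * (-((2 * (ε / 2) - a) / D)) = D ^ 2 := by
      field_simp; rw [ha]; ring
    have x3 : D ^ 2 ≤ e ^ 2 := by gcongr
    have x0 : 0 ≤ D ^ 3 * ((2 * 1 - a) / e) := by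
      have : 0 ≤ 2 * 1 - a := by rw [ha]; linarith
      positivity
    have y : 16 * D ^ 3 * (2 / a ^ 2 * ((2 * 1 - a) / e) - 2 / a ^ 2 * ((2 * (ε / 2) - a) / D))
      = 16 * (2 / a ^ 2) * (D ^ 3 * ((2 * 1 - a) / e) + D ^ 3 * (-((2 * (ε / 2) - a) / D))) := by
      ring
    rw [y, x2]
    have : (2 / a ^ 2) * (D ^ 3 * ((2 * 1 - a) / e) + D ^ 2) ≤ 2 * (e ^ 2 + e ^ 2) := by
      apply mul_le_mul ha2 (by linarith) (by positivity) (by norm_num)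
    linarith
  have hpi := Real.pi_gt_three
  have lo' : 2 * D * Real.pi - 72 * ε ≤ I := by
    have : 2 * D * (Real.pi - 36 * e) ≤ 2 * D * (A - B) := by
      apply mul_le_mul_of_nonneg_left _ (by positivity); linarith
    have : D * e ≤ e * e := by gcongr
    nlinarith
  have up' : I ≤ 2 * D * Real.pi + 64 * ε := by
    have : 2 * D * (A - B) ≤ 2 * D * Real.pi := by
      apply mul_le_mul_of_nonneg_left _ (by positivity); linarith
    linarith
  have s2 : √2 ^ 2 = 2 := Real.sq_sqrt (by norm_num)
  have s2p : 0 < √2 := by positivity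
  have d1 : √2 * e ≤ 2 * D := by
    apply (sq_le_sq₀ (by positivity) (by positivity)).1
    rw [mul_pow, mul_pow, s2, hD2, he2]; nlinarith
  have d2 : 2 * D ≤ √2 * e + ε := by
    apply (sq_le_sq₀ (by positivity) (by positivity)).1
    have : (√2 * e + ε) ^ 2 = √2 ^ 2 * e ^ 2 + ε ^ 2 + 2 * (√2 * e * ε) := by ring
    rw [this, mul_pow, s2, hD2, he2]
    have : 0 < √2 * e * ε := by positivity
    nlinarith
  have hm : ε * 3 ≤ ε * Real.pi := by gcongr
  have J1 : 2 * D - 24 * ε ≤ 1 / Real.pi * I := by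
    rw [one_div_mul_eq_div, le_div_iff₀ Real.pi_pos]; linarith
  have J2 : 1 / Real.pi * I ≤ 2 * D + 24 * ε := by
    rw [one_div_mul_eq_div, div_le_iff₀ Real.pi_pos]; linarith
  rw [abs_le]
  constructor <;> linarith

/-- **Short-time asymptotics for the 2d run and tumble (formula (5.4)):**
With `r(s,ε) = 1 + ε - s` and `x(s,ε) = (s² - r² + 1)/(2s)`, as `ε → 0+`,
`ε/2 + (1/π) ∫_{ε/2}^1 arccos((x(s,ε) - s)/r(s,ε)) ds = √2 √ε + O(ε)`. -/
theorem run_tumble_2d_short_time_asymptotics :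
    (fun ε : ℝ =>
        ε / 2 + (1 / Real.pi)
            * (∫ s in (ε / 2)..1,
                Real.arccos
                  (((s ^ 2 - (1 + ε - s) ^ 2 + 1) / (2 * s) - s) / (1 + ε - s)))
          - Real.sqrt 2 * Real.sqrt ε)
      =O[nhdsWithin 0 (Set.Ioi 0)] fun ε : ℝ => ε := by
  apply IsBigO.of_bound 100
  filter_upwards [Ioo_mem_nhdsGT (zero_lt_one : (0:ℝ) < 1)] with ε hε
  rw [Real.norm_eq_abs, Real.norm_of_nonneg hε.1.le]
  exact rt_main ε hε.1 hε.2
end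

section
/- As ε → 0+, ε/2 + ∫_{ε/2}^{1} ε(2+ε)/(4s(1 − s + ε)) ds = (1/2) ε (−2 ln ε + 1 + ln 2) + O(ε^2 ln(1/ε)). -/
open Filter Set Asymptotics intervalIntegral

lemma rt_integral (ε : ℝ) (h0 : 0 < ε) (h1 : ε < 1) :
    (∫ s in (ε / 2)..1, ε * (2 + ε) / (4 * s * (1 - s + ε))) =
      ε * (2 + ε) / (4 * (1 + ε)) * (-2 * Real.log ε + Real.log 2 + Real.log (1 + ε / 2)) := by
  have hu : Set.uIcc (ε / 2) 1 = Set.Icc (ε / 2) 1 := Set.uIcc_of_le (by linarith)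
  rw [integral_eq_sub_of_hasDerivAt (f := fun s : ℝ =>
    ε * (2 + ε) / (4 * (1 + ε)) * (Real.log s - Real.log (1 - s + ε)))]
  · have e1 : (1 : ℝ) - 1 + ε = ε := by ring
    have e2 : (1 : ℝ) - ε / 2 + ε = 1 + ε / 2 := by ring
    rw [e1, e2, Real.log_one, Real.log_div h0.ne' (by norm_num)]
    ring
  · intro s hs
    rw [hu] at hs
    have hs0 : 0 < s := by linarith [hs.1]
    have hs1 : 0 < 1 - s + ε := by linarith [hs.2]
    have hd : HasDerivAt (fun s : ℝ => 1 - s + ε) (-1) s :=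
      ((hasDerivAt_id s).const_sub 1).add_const ε
    have := ((Real.hasDerivAt_log hs0.ne').sub (hd.log hs1.ne')).const_mul
      (ε * (2 + ε) / (4 * (1 + ε)))
    refine this.congr_deriv ?_
    field_simp
    ring
  · apply ContinuousOn.intervalIntegrable
    rw [hu]
    apply ContinuousOn.div (by fun_prop) (by fun_prop)
    intro s hs
    have hs0 : 0 < s := by linarith [hs.1]
    have hs1 : 0 < 1 - s + ε := by linarith [hs.2]
    positivity

/-- **Short-time asymptotics for the 3d run and tumble (formula (6.4)):**
As `ε → 0+`,
`ε/2 + ∫_{ε/2}^1 ε(2+ε)/(4s(1-s+ε)) ds = (1/2) ε (-2 ln ε + 1 + ln 2) + O(ε² ln(1/ε))`. -/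
theorem run_tumble_3d_short_time_asymptotics :
    (fun ε : ℝ =>
        ε / 2 + (∫ s in (ε / 2)..1, ε * (2 + ε) / (4 * s * (1 - s + ε)))
          - (1 / 2) * ε * (-2 * Real.log ε + 1 + Real.log 2))
      =O[nhdsWithin 0 (Set.Ioi 0)] fun ε : ℝ => ε ^ 2 * Real.log (1 / ε) := by
  apply IsBigO.of_bound 2
  have hmem : Set.Ioo (0 : ℝ) (Real.exp (-1)) ∈ nhdsWithin (0 : ℝ) (Set.Ioi 0) :=
    Ioo_mem_nhdsGT (Real.exp_pos _)
  filter_upwards [hmem] with ε hε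
  obtain ⟨h0, h2⟩ := hε
  have h1 : ε < 1 := h2.trans (by rw [Real.exp_lt_one_iff]; norm_num)
  have hL : Real.log ε < -1 := by
    have := Real.log_lt_log h0 h2
    rwa [Real.log_exp] at this
  have hA0 : 0 ≤ Real.log (1 + ε / 2) := Real.log_nonneg (by linarith)
  have hA1 : Real.log (1 + ε / 2) ≤ ε / 2 := by
    have := Real.log_le_sub_one_of_pos (show 0 < 1 + ε / 2 by linarith)
    linarith
  have hl0 : 0 ≤ Real.log 2 := Real.log_nonneg (by norm_num)
  have hl1 : Real.log 2 ≤ 1 := by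
    have := Real.log_le_sub_one_of_pos (show (0 : ℝ) < 2 by norm_num)
    linarith
  rw [rt_integral ε h0 h1, one_div ε, Real.log_inv]
  generalize Real.log (1 + ε / 2) = A at *
  generalize Real.log 2 = l at *
  generalize Real.log ε = L at *
  obtain ⟨r, hr⟩ : ∃ r, r = ε / (2 * (1 + ε)) := ⟨_, rfl⟩
  have hr0 : 0 ≤ r := by rw [hr]; positivity
  have hr1 : r ≤ ε / 2 := by
    rw [hr]
    apply div_le_div_of_nonneg_left h0.le (by norm_num) (by linarith)
  have key : ε / 2 + ε * (2 + ε) / (4 * (1 + ε)) * (-2 * L + l + A)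
      - 1 / 2 * ε * (-2 * L + 1 + l) = ε / 2 * (A - r * (-2 * L + l + A)) := by
    rw [hr]; field_simp; ring
  have hB0 : 0 ≤ -2 * L + l + A := by linarith
  have hB1 : -2 * L + l + A ≤ -4 * L := by linarith
  have hP0 : 0 ≤ r * (-2 * L + l + A) := mul_nonneg hr0 hB0
  have hP1 : r * (-2 * L + l + A) ≤ ε / 2 * (-4 * L) := mul_le_mul hr1 hB1 hB0 (by linarith)
  have hεL : ε ≤ ε * (-L) := le_mul_of_one_le_right h0.le (by linarith)
  have hab : |A - r * (-2 * L + l + A)| ≤ 4 * (ε * (-L)) := by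
    rw [abs_le]; constructor <;> linarith
  rw [key, Real.norm_eq_abs, Real.norm_eq_abs, abs_mul, abs_of_pos (half_pos h0),
    abs_of_nonneg (mul_nonneg (sq_nonneg ε) (by linarith : 0 ≤ -L))]
  calc ε / 2 * _ ≤ ε / 2 * (4 * (ε * (-L))) := mul_le_mul_of_nonneg_left hab (by linarith)
    _ = _ := by ring
end

section
/- Let λ > 0 and θ ∈ (0,1), and set t0 := ln(1/θ). For ε > 0 and s1 ∈ (0, t0), define g(s1, ε) := ln((e^{s1} − 1) θ^ε + 1) − s1 − ε ln θ (which is positive for ε > 0). Then, as ε → 0+, ∫_0^{t0} ∫_0^{g(s1,ε)} λ^2 e^{−λ s1} e^{−λ s2} e^{−λ(t0 − s1 − s2)} ds2 ds1 = λ^2 θ^λ (θ − 1) ln(θ) · ε + O(ε^2). (Note (θ−1) ln θ > 0 for θ ∈ (0,1), so the leading coefficient is positive.) -/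
open Filter Set Asymptotics intervalIntegral

lemma aux_g (L s ε : ℝ) (hL : 0 < L) (hs : 0 ≤ s) (hε : 0 < ε) (hu : L * ε ≤ 1) :
    |Real.log ((Real.exp s - 1) * Real.exp (-(L * ε)) + 1) - s + L * ε
      - Real.exp (-s) * (L * ε)| ≤ 5 * (L * ε) ^ 2 := by
  set u := L * ε with hudef
  have hu0 : 0 < u := mul_pos hL hε
  have h1 : |Real.exp u - 1 - u| ≤ u ^ 2 :=
    Real.abs_exp_sub_one_sub_id_le (by rw [abs_of_pos hu0]; exact hu)
  have he : Real.exp u - 1 ≤ 2 * u := by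
    have := (abs_le.1 h1).2
    nlinarith
  have he0 : u ≤ Real.exp u - 1 := by linarith [Real.add_one_le_exp u]
  have hq0 : 0 < Real.exp (-s) := Real.exp_pos _
  have hq1 : Real.exp (-s) ≤ 1 := Real.exp_le_one_iff.2 (by linarith)
  set q := Real.exp (-s) with hq
  set y := q * (Real.exp u - 1) with hy
  have hy0 : 0 ≤ y := mul_nonneg hq0.le (by linarith)
  have hy2 : y ≤ 2 * u := by nlinarith
  have hfac : (Real.exp s - 1) * Real.exp (-u) + 1 = (1 + y) * Real.exp (s - u) := by
    have e1 : Real.exp (s - u) = Real.exp s * Real.exp (-u) := by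
      rw [← Real.exp_add]; ring_nf
    have e2 : q * Real.exp s = 1 := by rw [hq, ← Real.exp_add]; simp
    have e3 : Real.exp u * Real.exp (-u) = 1 := by rw [← Real.exp_add]; simp
    rw [e1, hy]
    linear_combination (-1 : ℝ) * e3 - (Real.exp u - 1) * Real.exp (-u) * e2
  have hlog : Real.log ((Real.exp s - 1) * Real.exp (-u) + 1) = Real.log (1 + y) + (s - u) := by
    rw [hfac, Real.log_mul (by linarith) (Real.exp_pos _).ne', Real.log_exp]
  have up : Real.log (1 + y) ≤ y := by
    have := Real.log_le_sub_one_of_pos (show 0 < 1 + y by linarith)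
    linarith
  have lo : y - y ^ 2 ≤ Real.log (1 + y) := by
    have h := Real.one_sub_inv_le_log_of_pos (show 0 < 1 + y by linarith)
    have h' : (1 + y)⁻¹ ≤ 1 - y + y ^ 2 := by
      rw [inv_le_iff_one_le_mul₀ (by linarith)]
      nlinarith [pow_nonneg hy0 3]
    linarith
  have h1' := (abs_le.1 h1).2
  have hyq : y - q * u ≤ u ^ 2 := by
    rw [hy]; nlinarith
  have hyq0 : 0 ≤ y - q * u := by
    rw [hy]; nlinarith
  have hyy : y ^ 2 ≤ 4 * u ^ 2 := by nlinarith
  rw [hlog, abs_le]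
  constructor <;> nlinarith

/-- **Short-time asymptotics for the linear PDMP (section 7, two-switch term):**
For switching rate `lam > 0` and threshold `θ ∈ (0,1)`, with `t0 = ln(1/θ)` and
`g(s1,ε) = ln((e^{s1} - 1) θ^ε + 1) - s1 - ε ln θ`, as `ε → 0+`,
`∫_0^{t0} ∫_0^{g(s1,ε)} lam² e^{-lam s1} e^{-lam s2} e^{-lam (t0 - s1 - s2)} ds2 ds1
  = lam² θ^lam (θ - 1) ln θ · ε + O(ε²)`. -/
theorem linear_pdmp_two_switch_asymptotics (lam θ : ℝ) (hlam : 0 < lam)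
    (hθ : θ ∈ Set.Ioo (0 : ℝ) 1) :
    (fun ε : ℝ =>
        (∫ s1 in (0 : ℝ)..(Real.log (1 / θ)),
          ∫ s2 in (0 : ℝ)..(Real.log ((Real.exp s1 - 1) * θ ^ ε + 1)
              - s1 - ε * Real.log θ),
            lam ^ 2 * Real.exp (-lam * s1) * Real.exp (-lam * s2)
              * Real.exp (-lam * (Real.log (1 / θ) - s1 - s2)))
          - lam ^ 2 * θ ^ lam * (θ - 1) * Real.log θ * ε)
      =O[nhdsWithin 0 (Set.Ioi 0)] fun ε : ℝ => ε ^ 2 := by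
  obtain ⟨h0, h1⟩ := hθ
  have hlogeq : Real.log (1 / θ) = - Real.log θ := by rw [one_div, Real.log_inv]
  have hLpos : 0 < - Real.log θ := by linarith [Real.log_neg h0 h1]
  rw [hlogeq]
  set L := - Real.log θ with hL
  have hlt : Real.log θ = -L := by rw [hL]; ring
  have hθe : θ = Real.exp (-L) := by rw [← hlt, Real.exp_log h0]
  have hpow : ∀ x : ℝ, θ ^ x = Real.exp (-(L * x)) := by
    intro x
    rw [Real.rpow_def_of_pos h0, hlt]; ring_nf
  set c := lam ^ 2 * θ ^ lam with hc
  have hc0 : 0 ≤ c := by positivity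
  refine IsBigO.of_bound (c * (5 * L ^ 2 * L)) ?_
  have hmem : Set.Ioo (0 : ℝ) (1 / L) ∈ nhdsWithin (0 : ℝ) (Set.Ioi 0) :=
    Ioo_mem_nhdsGT (by positivity)
  filter_upwards [hmem] with ε hε
  obtain ⟨hε0, hε1⟩ := hε
  have hu : L * ε ≤ 1 := by
    rw [lt_div_iff₀ hLpos] at hε1
    linarith
  have hinner : ∀ s1 s2 : ℝ, lam ^ 2 * Real.exp (-lam * s1) * Real.exp (-lam * s2)
              * Real.exp (-lam * (L - s1 - s2)) = c := by
    intro s1 s2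
    rw [hc, hpow, mul_assoc, mul_assoc, ← Real.exp_add, ← Real.exp_add]
    ring_nf
  simp only [hinner, intervalIntegral.integral_const, smul_eq_mul, sub_zero]
  rw [intervalIntegral.integral_mul_const, hpow ε, hlt]
  have hint : ∫ s in (0 : ℝ)..L, Real.exp (-s) * (L * ε) = (1 - θ) * (L * ε) := by
    rw [intervalIntegral.integral_mul_const, intervalIntegral.integral_comp_neg
      (fun x => Real.exp x), integral_exp, hθe]
    simp
  have hcont : ContinuousOn (fun s : ℝ => Real.log ((Real.exp s - 1) * Real.exp (-(L * ε)) + 1)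
      - s - ε * -L) (Set.uIcc 0 L) := by
    refine ContinuousOn.sub (ContinuousOn.sub (ContinuousOn.log (by fun_prop) ?_)
      (by fun_prop)) (by fun_prop)
    intro s hs
    rw [Set.uIcc_of_le hLpos.le] at hs
    have : 0 ≤ Real.exp s - 1 := by linarith [Real.add_one_le_exp s, hs.1]
    have := mul_nonneg this (Real.exp_pos (-(L * ε))).le
    linarith
  have hcont2 : Continuous (fun s : ℝ => Real.exp (-s) * (L * ε)) := by fun_prop
  have hsub := intervalIntegral.integral_sub (μ := MeasureTheory.volume)
    hcont.intervalIntegrable (hcont2.intervalIntegrable 0 L)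
  have hb := intervalIntegral.norm_integral_le_of_norm_le_const (a := 0) (b := L)
    (C := 5 * (L * ε) ^ 2) (f := fun s : ℝ =>
      (Real.log ((Real.exp s - 1) * Real.exp (-(L * ε)) + 1) - s - ε * -L)
        - Real.exp (-s) * (L * ε)) (by
      intro s hs
      rw [Set.uIoc_of_le hLpos.le] at hs
      have := aux_g L s ε hLpos hs.1.le hε0 hu
      rw [Real.norm_eq_abs]
      convert this using 2
      ring)
  rw [hsub, hint, sub_zero, abs_of_pos hLpos] at hb
  rw [Real.norm_of_nonneg (sq_nonneg ε)]
  set I := ∫ s in (0 : ℝ)..L, (Real.log ((Real.exp s - 1) * Real.exp (-(L * ε)) + 1)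
      - s - ε * -L)
  have : I * c - c * (θ - 1) * -L * ε = c * (I - (1 - θ) * (L * ε)) := by ring
  rw [this, norm_mul, Real.norm_of_nonneg hc0]
  calc c * ‖I - (1 - θ) * (L * ε)‖ ≤ c * (5 * (L * ε) ^ 2 * L) :=
        mul_le_mul_of_nonneg_left hb hc0
    _ = _ := by ring
end
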